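/- (Lemma 1) For i = 1,…,N (N ≥ 2), let f_i : ℝ → ℝ be twice continuously differentiable with h̲ ≤ f_i''(s) ≤ h̄ for all s ∈ ℝ, where 0 < h̲ ≤ h̄, let F : ℝ^N → ℝ^N be the stacked gradient map F(z) = (f_1'(z_1), …, f_N'(z_N)), and let y* be the unique minimizer of f = Σ_{i=1}^N f_i. Let L ∈ ℝ^{N×N} satisfy L𝟙 = 0 and 𝟙ᵀL = 0, and suppose there are constants 0 < λ₂ ≤ λ_N such that for every x ∈ ℝ^N with 𝟙ᵀx = 0: λ₂‖x‖² ≤ xᵀLx and ‖Lx‖ ≤ λ_N‖x‖. Fix η > 0 and choose α ≥ max{1, 2η/min{h̲, λ₂}, 6h̄²/(h̲λ₂)} and β ≥ max{1, 7α²λ_N²/λ₂²}. Let z, v : [0,∞) → ℝ^N be continuously differentiable and satisfy for all t ≥ 0: ż(t) = −α·F(z(t)) − β·L z(t) − L v(t) and v̇(t) = αβ·L z(t). Then there exists a constant K ≥ 0 such that ‖z(t) − y*·𝟙‖ ≤ K·e^{−ηt} for all t ≥ 0; in particular |z_i(t) − y*|·e^{ηt} is bounded for each i. -/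

import Mathlib

open scoped Matrix

/-- A function on `[0, ∞)` whose derivative is at most `-k W` decays like `exp (-k t)`. -/
lemma le_mul_exp_of_deriv_le_neg_mul {W W' : ℝ → ℝ} {k : ℝ}
    (hW : ∀ t, 0 ≤ t → HasDerivAt W (W' t) t) (hle : ∀ t, 0 ≤ t → W' t ≤ -k * W t)
    {t : ℝ} (ht : 0 ≤ t) : W t ≤ W 0 * Real.exp (-k * t) := by
  have hd : ∀ s, 0 ≤ s → HasDerivAt (fun s => W s * Real.exp (k * s))
      (W' s * Real.exp (k * s) + W s * (Real.exp (k * s) * k)) s := fun s hs => by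
    have h1 : HasDerivAt (fun s : ℝ => k * s) k s := by
      simpa using (hasDerivAt_id s).const_mul k
    exact (hW s hs).mul h1.exp
  have hanti : AntitoneOn (fun s => W s * Real.exp (k * s)) (Set.Ici 0) := by
    refine antitoneOn_of_deriv_nonpos (convex_Ici 0)
      (fun s hs => (hd s hs).continuousAt.continuousWithinAt)
      (fun s hs => (hd s (interior_subset hs)).differentiableAt.differentiableWithinAt)
      (fun s hs => ?_)
    have hs0 : 0 ≤ s := interior_subset hs
    rw [(hd s hs0).deriv]
    nlinarith [hle s hs0, Real.exp_pos (k * s)]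
  have h := hanti (Set.mem_Ici.2 le_rfl) (Set.mem_Ici.2 ht) ht
  simp only [mul_zero, Real.exp_zero, mul_one] at h
  have hexp : Real.exp (k * t) * Real.exp (-k * t) = 1 := by
    rw [← Real.exp_add]; simp
  calc W t = W t * Real.exp (k * t) * Real.exp (-k * t) := by rw [mul_assoc, hexp, mul_one]
    _ ≤ W 0 * Real.exp (-k * t) := by gcongr

/-- Secant bounds for a function whose derivative lies in `[m, M]`. -/
lemma secant_bounds {g : ℝ → ℝ} (hg : Differentiable ℝ g) {m M : ℝ} (hm : 0 ≤ m)
    (hb : ∀ s, m ≤ deriv g s ∧ deriv g s ≤ M) (x y : ℝ) :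
    m * (x - y) ^ 2 ≤ (x - y) * (g x - g y) ∧
      (g x - g y) ^ 2 ≤ M * ((x - y) * (g x - g y)) := by
  obtain ⟨k, hk1, hk2, hk⟩ : ∃ k, m ≤ k ∧ k ≤ M ∧ g x - g y = k * (x - y) := by
    rcases lt_trichotomy x y with h | h | h
    · obtain ⟨c, -, hc⟩ := exists_deriv_eq_slope g h hg.continuous.continuousOn
        hg.differentiableOn
      refine ⟨deriv g c, (hb c).1, (hb c).2, ?_⟩
      rw [hc]; field_simp [sub_ne_zero.2 h.ne']; ring
    · exact ⟨m, le_rfl, (hb 0).1.trans (hb 0).2, by simp [h]⟩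
    · obtain ⟨c, -, hc⟩ := exists_deriv_eq_slope g h hg.continuous.continuousOn
        hg.differentiableOn
      refine ⟨deriv g c, (hb c).1, (hb c).2, ?_⟩
      rw [hc]; field_simp [sub_ne_zero.2 h.ne']
  rw [hk]
  constructor
  · nlinarith [mul_le_mul_of_nonneg_right hk1 (sq_nonneg (x - y))]
  · have h0 : 0 ≤ k := hm.trans hk1
    nlinarith [mul_le_mul_of_nonneg_right hk2 (mul_nonneg h0 (sq_nonneg (x - y)))]

lemma sum_mulVec_eq_zero {ι : Type*} [Fintype ι] {L : Matrix ι ι ℝ}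
    (h1L : Matrix.vecMul (fun _ => (1 : ℝ)) L = 0) (x : ι → ℝ) : ∑ i, (L *ᵥ x) i = 0 := by
  have h := Matrix.dotProduct_mulVec (fun _ => (1 : ℝ)) L x
  rw [h1L, zero_dotProduct] at h
  simpa [dotProduct] using h

/-- A matrix with zero column sums that is injective on the zero-sum vectors has every zero-sum
vector in its range. -/
lemma exists_mulVec_eq_of_sum_eq_zero {ι : Type*} [Fintype ι] [Nonempty ι]
    {L : Matrix ι ι ℝ} (h1L : Matrix.vecMul (fun _ => (1 : ℝ)) L = 0)
    (hinj : ∀ x : ι → ℝ, ∑ i, x i = 0 → L *ᵥ x = 0 → x = 0)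
    {b : ι → ℝ} (hb : ∑ i, b i = 0) : ∃ u, L *ᵥ u = b := by
  let J : (ι → ℝ) →ₗ[ℝ] (ι → ℝ) :=
    { toFun := fun x _ => ∑ i, x i
      map_add' := fun x y => by ext; simp [Finset.sum_add_distrib]
      map_smul' := fun c x => by ext; simp [Finset.mul_sum] }
  have hsum : ∀ x, ∑ i, (L.mulVecLin + J) x i = Fintype.card ι * ∑ i, x i := fun x => by
    simp [J, Finset.sum_add_distrib, sum_mulVec_eq_zero h1L]
  have hcard : (Fintype.card ι : ℝ) ≠ 0 := by simp
  have hzero : ∀ x, ∑ i, (L.mulVecLin + J) x i = 0 →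
      ∑ i, x i = 0 ∧ (L.mulVecLin + J) x = L *ᵥ x := fun x hx => by
    have h0 : ∑ i, x i = 0 := (mul_eq_zero.1 ((hsum x).symm.trans hx)).resolve_left hcard
    exact ⟨h0, by ext; simp [J, h0]⟩
  have hi : Function.Injective (L.mulVecLin + J) := by
    refine (injective_iff_map_eq_zero _).2 fun x hx => ?_
    obtain ⟨h0, h1⟩ := hzero x (by simp [hx])
    exact hinj x h0 (h1.symm.trans hx)
  obtain ⟨u, hu⟩ := LinearMap.injective_iff_surjective.1 hi b
  exact ⟨u, (hzero u (by rw [hu, hb])).2.symm.trans hu⟩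

/-- Scalar form of the Lyapunov estimate: `x`, `y` are the norms of the disagreement vector and of
the slow variable. -/
lemma lyapunov_scalar {hl hu lam2 lamN eta α β E S H x y A B X Y Z : ℝ}
    (hl_pos : 0 < hl) (hlu : hl ≤ hu) (h2pos : 0 < lam2) (h2N : lam2 ≤ lamN)
    (hα1 : 1 ≤ α) (hαl : 2 * eta ≤ α * hl) (hα2 : 2 * eta ≤ α * lam2)
    (hαu : 6 * hu ^ 2 ≤ α * (hl * lam2)) (hβ : 7 * α ^ 2 * lamN ^ 2 ≤ β * lam2 ^ 2)
    (hE : 0 ≤ E) (hx : 0 ≤ x) (hy : 0 ≤ y)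
    (hS : hl * E ≤ S) (hH : H ≤ hu * S) (hA : lam2 * x ^ 2 ≤ A) (hB : lam2 * y ^ 2 ≤ B)
    (hX : |X| ≤ lamN * (x * y)) (hY : |Y| ≤ lamN * (x * y)) (hZ : Z ^ 2 ≤ y ^ 2 * H) :
    α ^ 3 / 3 * (-α * S - (β - α) * A - X) + (-α * B + α ^ 2 * Y - α ^ 2 * Z) ≤
      -eta * (α ^ 3 / 3 * E + y ^ 2) := by
  have hα0 : 0 < α := by linarith
  have hu0 : 0 < hu := hl_pos.trans_le hlu
  have hN0 : 0 < lamN := h2pos.trans_le h2N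
  have hS0 : 0 ≤ S := (mul_nonneg hl_pos.le hE).trans hS
  have hα6 : 6 * hu ≤ α * lam2 := by
    have : hl * (6 * hu) ≤ hl * (α * lam2) := by
      linarith [mul_le_mul_of_nonneg_right hlu hu0.le]
    exact le_of_mul_le_mul_left this hl_pos
  have hβα : 6 * α ^ 2 * lamN ^ 2 ≤ (β - α) * lam2 ^ 2 := by
    have h1 : lam2 ^ 2 ≤ lamN ^ 2 := by gcongr
    have h2 : α ≤ α ^ 2 := le_self_pow₀ hα1 two_ne_zero
    have h3 : α * lam2 ^ 2 ≤ α ^ 2 * lamN ^ 2 := by gcongr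
    linarith
  have hβα0 : 0 ≤ β - α := by
    have : 0 ≤ (β - α) * lam2 ^ 2 := le_trans (by positivity) hβα
    exact nonneg_of_mul_nonneg_left this (by positivity)
  set μ := α ^ 2 * lamN * x / lam2 with hμ
  have hμ' : α ^ 2 * (lamN * x) = lam2 * μ := by rw [hμ]; field_simp
  have hT : α ^ 3 / 3 * (-X) + α ^ 2 * Y ≤ 4 / 3 * α * lam2 * (μ * y) := by
    have h1 : α ^ 2 ≤ α ^ 3 := pow_le_pow_right₀ hα1 (by norm_num)
    have hxy : 0 ≤ lamN * (x * y) := by positivity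
    calc α ^ 3 / 3 * (-X) + α ^ 2 * Y
        ≤ α ^ 3 / 3 * (lamN * (x * y)) + α ^ 3 * (lamN * (x * y)) := by
          refine add_le_add (mul_le_mul_of_nonneg_left ((neg_le_abs X).trans hX) (by positivity))
            ?_
          exact (mul_le_mul_of_nonneg_left ((le_abs_self Y).trans hY) (by positivity)).trans
            (mul_le_mul_of_nonneg_right h1 hxy)
      _ = 4 / 3 * α * (α ^ 2 * (lamN * x)) * y := by ring
      _ = 4 / 3 * α * lam2 * (μ * y) := by rw [hμ']; ring
  have hQ : 2 * α * lam2 * μ ^ 2 ≤ α ^ 3 / 3 * ((β - α) * A) := by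
    have h1 : (β - α) * (lam2 * x ^ 2) ≤ (β - α) * A := mul_le_mul_of_nonneg_left hA hβα0
    have h2 : 6 * (lam2 * μ ^ 2) ≤ α ^ 2 * ((β - α) * (lam2 * x ^ 2)) := by
      have h3 : lam2 * (6 * (lam2 * μ ^ 2)) ≤ lam2 * (α ^ 2 * ((β - α) * (lam2 * x ^ 2))) := by
        calc lam2 * (6 * (lam2 * μ ^ 2)) = 6 * (lam2 * μ) ^ 2 := by ring
          _ = α ^ 2 * x ^ 2 * (6 * α ^ 2 * lamN ^ 2) := by rw [← hμ']; ring
          _ ≤ α ^ 2 * x ^ 2 * ((β - α) * lam2 ^ 2) :=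
              mul_le_mul_of_nonneg_left hβα (by positivity)
          _ = lam2 * (α ^ 2 * ((β - α) * (lam2 * x ^ 2))) := by ring
      exact le_of_mul_le_mul_left h3 h2pos
    have h4 := mul_le_mul_of_nonneg_left h1 (sq_nonneg α)
    have h5 := mul_le_mul_of_nonneg_left (h2.trans h4) hα0.le
    linarith
  have hZ' : -(α ^ 2 * Z) ≤ α * lam2 / 4 * y ^ 2 + α ^ 4 / 6 * S := by
    have h1 : α ^ 4 * Z ^ 2 ≤ 4 * (α * lam2 / 4 * y ^ 2) * (α ^ 4 / 6 * S) := by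
      calc α ^ 4 * Z ^ 2 ≤ α ^ 4 * (y ^ 2 * (hu * S)) := by
            have := mul_le_mul_of_nonneg_left hH (sq_nonneg y)
            exact mul_le_mul_of_nonneg_left (hZ.trans this) (by positivity)
        _ = α ^ 4 * y ^ 2 * S / 6 * (6 * hu) := by ring
        _ ≤ α ^ 4 * y ^ 2 * S / 6 * (α * lam2) :=
            mul_le_mul_of_nonneg_left hα6 (by positivity)
        _ = 4 * (α * lam2 / 4 * y ^ 2) * (α ^ 4 / 6 * S) := by ring
    have h2 : 0 ≤ α * lam2 / 4 * y ^ 2 + α ^ 4 / 6 * S := by positivity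
    refine (neg_le_abs _).trans (abs_le_of_sq_le_sq ?_ h2)
    linarith only [h1, sq_nonneg (α * lam2 / 4 * y ^ 2 - α ^ 4 / 6 * S)]
  have hB' : α * lam2 * y ^ 2 ≤ α * B := by
    linarith [mul_le_mul_of_nonneg_left hB hα0.le]
  have hquad : 0 ≤ α * lam2 * (y ^ 2 / 4 + 2 * μ ^ 2 - 4 / 3 * (μ * y)) :=
    mul_nonneg (by positivity) (by linarith [sq_nonneg (y / 2 - 4 / 3 * μ), sq_nonneg μ])
  have hηE : eta * (α ^ 3 / 3 * E) ≤ α ^ 4 / 6 * S := by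
    have h1 : 2 * eta * E ≤ α * S := by
      linarith [mul_le_mul_of_nonneg_right hαl hE, mul_le_mul_of_nonneg_left hS hα0.le]
    have := mul_le_mul_of_nonneg_left h1 (show 0 ≤ α ^ 3 / 6 by positivity)
    linarith
  have hηy : eta * y ^ 2 ≤ α * lam2 / 2 * y ^ 2 := by
    linarith [mul_le_mul_of_nonneg_right hα2 (sq_nonneg y)]
  linarith only [hT, hQ, hZ', hB', hquad, hηE, hηy]

lemma abs_dotProduct_le_of_sqrt_le {ι : Type*} [Fintype ι] {a b : ι → ℝ} {c : ℝ}
    (hb : Real.sqrt (∑ i, b i ^ 2) ≤ c) :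
    |a ⬝ᵥ b| ≤ Real.sqrt (∑ i, a i ^ 2) * c := by
  refine (Real.abs_le_sqrt (Finset.sum_mul_sq_le_sq_mul_sq Finset.univ a b)).trans ?_
  rw [Real.sqrt_mul (Finset.sum_nonneg fun i _ => sq_nonneg _)]
  gcongr

/-- Lyapunov estimate for the error `e` and the slow variable `p`, with `h` the gradient
difference. -/
lemma lyapunov_vector {ι : Type*} [Fintype ι] [Nonempty ι]
    {hl hu lam2 lamN eta α β : ℝ} {L : Matrix ι ι ℝ}
    (hL1 : L *ᵥ (fun _ => (1 : ℝ)) = 0)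
    (h1L : Matrix.vecMul (fun _ => (1 : ℝ)) L = 0)
    (hquad : ∀ x : ι → ℝ, ∑ i, x i = 0 →
      lam2 * ∑ i, (x i) ^ 2 ≤ x ⬝ᵥ (L *ᵥ x) ∧
      Real.sqrt (∑ i, ((L *ᵥ x) i) ^ 2) ≤ lamN * Real.sqrt (∑ i, (x i) ^ 2))
    (hl_pos : 0 < hl) (hlu : hl ≤ hu) (h2pos : 0 < lam2) (h2N : lam2 ≤ lamN)
    (hα1 : 1 ≤ α) (hαl : 2 * eta ≤ α * hl) (hα2 : 2 * eta ≤ α * lam2)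
    (hαu : 6 * hu ^ 2 ≤ α * (hl * lam2)) (hβ : 7 * α ^ 2 * lamN ^ 2 ≤ β * lam2 ^ 2)
    {e p h : ι → ℝ} (hp : ∑ i, p i = 0) (he : ∀ i, hl * e i ^ 2 ≤ e i * h i)
    (hh : ∀ i, h i ^ 2 ≤ hu * (e i * h i)) :
    α ^ 3 / 3 * (e ⬝ᵥ (-α • h - (β - α) • (L *ᵥ e) - L *ᵥ p)) +
      p ⬝ᵥ (-α • (L *ᵥ p) + α ^ 2 • (L *ᵥ e) - α ^ 2 • h) ≤
      -eta * (α ^ 3 / 3 * ∑ i, e i ^ 2 + ∑ i, p i ^ 2) := by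
  set m : ℝ := (∑ i, e i) / Fintype.card ι with hm
  set q : ι → ℝ := fun i => e i - m with hq
  have heq : e = q + m • (fun _ => (1 : ℝ)) := by ext; simp [hq]
  have hqs : ∑ i, q i = 0 := by
    have : (Fintype.card ι : ℝ) ≠ 0 := by simp
    simp only [hq, Finset.sum_sub_distrib, Finset.sum_const, Finset.card_univ, nsmul_eq_mul, hm]
    field_simp; ring
  have hLe : L *ᵥ e = L *ᵥ q := by
    rw [heq, Matrix.mulVec_add, Matrix.mulVec_smul, hL1]; simp
  have hdot : ∀ x, e ⬝ᵥ (L *ᵥ x) = q ⬝ᵥ (L *ᵥ x) := fun x => by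
    rw [heq, add_dotProduct, smul_dotProduct, Matrix.dotProduct_mulVec (fun _ => (1 : ℝ)), h1L]
    simp
  have hsq : ∀ x : ι → ℝ, Real.sqrt (∑ i, x i ^ 2) ^ 2 = ∑ i, x i ^ 2 := fun x =>
    Real.sq_sqrt (Finset.sum_nonneg fun i _ => sq_nonneg _)
  have key := lyapunov_scalar (E := ∑ i, e i ^ 2) (S := e ⬝ᵥ h) (H := ∑ i, h i ^ 2)
    (x := Real.sqrt (∑ i, q i ^ 2)) (y := Real.sqrt (∑ i, p i ^ 2))
    (A := q ⬝ᵥ (L *ᵥ q)) (B := p ⬝ᵥ (L *ᵥ p)) (X := q ⬝ᵥ (L *ᵥ p)) (Y := p ⬝ᵥ (L *ᵥ q))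
    (Z := p ⬝ᵥ h) hl_pos hlu h2pos h2N hα1 hαl hα2 hαu hβ
    (Finset.sum_nonneg fun i _ => sq_nonneg _) (Real.sqrt_nonneg _) (Real.sqrt_nonneg _)
    (by rw [Finset.mul_sum]; exact Finset.sum_le_sum fun i _ => he i)
    (by rw [dotProduct, Finset.mul_sum]; exact Finset.sum_le_sum fun i _ => hh i)
    (by rw [hsq]; exact (hquad q hqs).1) (by rw [hsq]; exact (hquad p hp).1)
    ((abs_dotProduct_le_of_sqrt_le (hquad p hp).2).trans_eq (by ring))
    ((abs_dotProduct_le_of_sqrt_le (hquad q hqs).2).trans_eq (by ring))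
    (by rw [hsq]; exact Finset.sum_mul_sq_le_sq_mul_sq Finset.univ p h)
  rw [hsq] at key
  refine le_of_eq_of_le ?_ key
  simp only [dotProduct_sub, dotProduct_add, dotProduct_smul, hdot, hLe, smul_eq_mul]


/-- Lemma 1: Along the trajectory of the optimal signal generator
`ż = −αF(z) − βLz − Lv`, `v̇ = αβLz`, with gains `α, β` chosen as in the paper,
`z(t)` converges to `y* 𝟙` exponentially with rate `η`; in particular
`|z_i(t) − y*| e^{ηt}` is bounded for each `i`. -/
theorem stmt_5 (N : ℕ) (hN : 2 ≤ N) (f : Fin N → ℝ → ℝ) (hl hu : ℝ)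
    (hl_pos : 0 < hl) (hlu : hl ≤ hu)
    (hsmooth : ∀ i, ContDiff ℝ 2 (f i))
    (hbound : ∀ i s, hl ≤ deriv (deriv (f i)) s ∧ deriv (deriv (f i)) s ≤ hu)
    (ystar : ℝ) (hy : ∀ s : ℝ, ∑ i, f i ystar ≤ ∑ i, f i s)
    (L : Matrix (Fin N) (Fin N) ℝ)
    (hL1 : L *ᵥ (fun _ => (1 : ℝ)) = 0)
    (h1L : Matrix.vecMul (fun _ => (1 : ℝ)) L = 0)
    (lam2 lamN : ℝ) (h2pos : 0 < lam2) (h2N : lam2 ≤ lamN)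
    (hquad : ∀ x : Fin N → ℝ, ∑ i, x i = 0 →
      lam2 * ∑ i, (x i) ^ 2 ≤ x ⬝ᵥ (L *ᵥ x) ∧
      Real.sqrt (∑ i, ((L *ᵥ x) i) ^ 2) ≤ lamN * Real.sqrt (∑ i, (x i) ^ 2))
    (eta : ℝ) (heta : 0 < eta)
    (α β : ℝ)
    (hα : α ≥ max 1 (max (2 * eta / min hl lam2) (6 * hu ^ 2 / (hl * lam2))))
    (hβ : β ≥ max 1 (7 * α ^ 2 * lamN ^ 2 / lam2 ^ 2))
    (z v : ℝ → Fin N → ℝ)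
    (hz : ∀ t, 0 ≤ t → HasDerivAt z
      (fun i => -α * deriv (f i) (z t i) - β * (L *ᵥ z t) i - (L *ᵥ v t) i) t)
    (hv : ∀ t, 0 ≤ t → HasDerivAt v (fun i => α * β * (L *ᵥ z t) i) t) :
    ∃ K : ℝ, 0 ≤ K ∧
      (∀ t, 0 ≤ t → Real.sqrt (∑ i, (z t i - ystar) ^ 2) ≤ K * Real.exp (-eta * t)) ∧
      (∀ i, ∀ t, 0 ≤ t → |z t i - ystar| * Real.exp (eta * t) ≤ K) := by
  have : Nonempty (Fin N) := ⟨⟨0, by omega⟩⟩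
  have hα1 : 1 ≤ α := (le_max_left _ _).trans hα
  have hα0 : 0 < α := by linarith
  have hmin : 2 * eta ≤ α * min hl lam2 := by
    have h := ((le_max_left _ _).trans (le_max_right _ _)).trans hα
    rwa [div_le_iff₀ (lt_min hl_pos h2pos)] at h
  have hαl : 2 * eta ≤ α * hl := hmin.trans (by gcongr; exact min_le_left _ _)
  have hα2 : 2 * eta ≤ α * lam2 := hmin.trans (by gcongr; exact min_le_right _ _)
  have hαu : 6 * hu ^ 2 ≤ α * (hl * lam2) := by
    have h := ((le_max_right _ _).trans (le_max_right _ _)).trans hα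
    rwa [div_le_iff₀ (mul_pos hl_pos h2pos)] at h
  have hβ7 : 7 * α ^ 2 * lamN ^ 2 ≤ β * lam2 ^ 2 := by
    have h := (le_max_right _ _).trans hβ
    rwa [div_le_iff₀ (pow_pos h2pos 2)] at h
  have hstat : ∑ i, deriv (f i) ystar = 0 := by
    have hd : HasDerivAt (fun s => ∑ i, f i s) (∑ i, deriv (f i) ystar) ystar :=
      HasDerivAt.fun_sum fun i _ =>
        (((hsmooth i).differentiable (by norm_num)) ystar).hasDerivAt
    exact IsLocalMin.hasDerivAt_eq_zero (Filter.Eventually.of_forall hy) hd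
  have hinj : ∀ x : Fin N → ℝ, ∑ i, x i = 0 → L *ᵥ x = 0 → x = 0 := fun x hx hLx => by
    have h := (hquad x hx).1
    rw [hLx, dotProduct_zero] at h
    have hle : ∑ i, x i ^ 2 ≤ 0 := by nlinarith
    have h0 := le_antisymm hle (Finset.sum_nonneg fun i _ => sq_nonneg (x i))
    rw [Finset.sum_eq_zero_iff_of_nonneg fun i _ => sq_nonneg (x i)] at h0
    ext i
    simpa using h0 i (Finset.mem_univ i)
  obtain ⟨u, hu_eq⟩ := exists_mulVec_eq_of_sum_eq_zero h1L hinj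
    (b := fun i => -α * deriv (f i) ystar) (by rw [← Finset.mul_sum, hstat, mul_zero])
  have hu_i : ∀ i, (L *ᵥ u) i = -α * deriv (f i) ystar := fun i => congrFun hu_eq i
  set e : ℝ → Fin N → ℝ := fun t i => z t i - ystar with he
  set h : ℝ → Fin N → ℝ := fun t i => deriv (f i) (z t i) - deriv (f i) ystar with hh
  set r : ℝ → Fin N → ℝ := fun t i => α * e t i + v t i - u i with hr
  set m : ℝ → ℝ := fun t => (∑ i, r t i) / Fintype.card (Fin N) with hm
  set p : ℝ → Fin N → ℝ := fun t i => r t i - m t with hp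
  have hps : ∀ t, ∑ i, p t i = 0 := fun t => by
    simp only [hp, hm, Finset.sum_sub_distrib, Finset.sum_const, Finset.card_univ, nsmul_eq_mul]
    field_simp; ring
  have hLe : ∀ t, L *ᵥ e t = L *ᵥ z t := fun t => by
    have : e t = z t - ystar • (fun _ => (1 : ℝ)) := by ext; simp [he]
    rw [this, Matrix.mulVec_sub, Matrix.mulVec_smul, hL1]; simp
  have hLp : ∀ t, L *ᵥ p t = α • (L *ᵥ z t) + L *ᵥ v t - L *ᵥ u := fun t => by
    have : p t = α • e t + v t - u - m t • (fun _ => (1 : ℝ)) := by ext; simp [hp, hr]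
    rw [this, Matrix.mulVec_sub, Matrix.mulVec_smul, hL1, Matrix.mulVec_sub, Matrix.mulVec_add,
      Matrix.mulVec_smul, hLe]
    simp
  set e' : ℝ → Fin N → ℝ := fun t => -α • h t - (β - α) • (L *ᵥ e t) - L *ᵥ p t with he'
  set r' : ℝ → Fin N → ℝ :=
    fun t => -α • (L *ᵥ p t) + α ^ 2 • (L *ᵥ e t) - α ^ 2 • h t with hr'
  have hde : ∀ t, 0 ≤ t → ∀ i, HasDerivAt (fun s => e s i) (e' t i) t := fun t ht i => by
    refine ((hasDerivAt_pi.1 (hz t ht) i).sub_const ystar).congr_deriv ?_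
    simp only [he', hh, hLe, hLp, Pi.sub_apply, Pi.add_apply, Pi.smul_apply, smul_eq_mul, hu_i]
    ring
  have hdr : ∀ t, 0 ≤ t → ∀ i, HasDerivAt (fun s => r s i) (r' t i) t := fun t ht i => by
    refine ((((hde t ht i).const_mul α).add (hasDerivAt_pi.1 (hv t ht) i)).sub_const
      (u i)).congr_deriv ?_
    simp only [he', hr', hLe, Pi.sub_apply, Pi.add_apply, Pi.smul_apply, smul_eq_mul]
    ring
  set m' : ℝ → ℝ := fun t => (∑ i, r' t i) / Fintype.card (Fin N) with hm'
  have hdp : ∀ t, 0 ≤ t → ∀ i, HasDerivAt (fun s => p s i) (r' t i - m' t) t := fun t ht i =>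
    (hdr t ht i).sub ((HasDerivAt.fun_sum fun j _ => hdr t ht j).div_const _)
  set W : ℝ → ℝ := fun t => α ^ 3 / 3 * ∑ i, e t i ^ 2 + ∑ i, p t i ^ 2 with hW
  have hdW : ∀ t, 0 ≤ t →
      HasDerivAt W (2 * (α ^ 3 / 3 * (e t ⬝ᵥ e' t) + p t ⬝ᵥ r' t)) t := fun t ht => by
    have h1 : HasDerivAt (fun s => ∑ i, e s i ^ 2) (∑ i, 2 * (e t i * e' t i)) t :=
      HasDerivAt.fun_sum fun i _ => ((hde t ht i).pow 2).congr_deriv (by simp; ring)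
    have h2 : HasDerivAt (fun s => ∑ i, p s i ^ 2)
        (∑ i, 2 * (p t i * r' t i - m' t * p t i)) t :=
      HasDerivAt.fun_sum fun i _ => ((hdp t ht i).pow 2).congr_deriv (by simp; ring)
    refine ((h1.const_mul (α ^ 3 / 3)).add h2).congr_deriv ?_
    rw [← Finset.mul_sum, ← Finset.mul_sum, Finset.sum_sub_distrib, ← Finset.mul_sum, hps]
    simp only [dotProduct]
    ring
  have hdecay : ∀ t, 0 ≤ t → W t ≤ W 0 * Real.exp (-(2 * eta) * t) := fun t ht => by
    refine le_mul_exp_of_deriv_le_neg_mul hdW (fun s _ => ?_) ht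
    have hsec := fun i => secant_bounds
      (((contDiff_succ_iff_deriv (n := 1)).1 (hsmooth i)).2.2.differentiable (by norm_num))
      hl_pos.le (hbound i) (z s i) ystar
    have := lyapunov_vector hL1 h1L hquad hl_pos hlu h2pos h2N hα1 hαl hα2 hαu hβ7
      (e := e s) (h := h s) (hps s) (fun i => (hsec i).1) (fun i => (hsec i).2)
    change α ^ 3 / 3 * (e s ⬝ᵥ e' s) + p s ⬝ᵥ r' s ≤ -eta * W s at this
    linarith
  have hc : 0 < α ^ 3 / 3 := by positivity
  have hnorm : ∀ t, 0 ≤ t → Real.sqrt (∑ i, (z t i - ystar) ^ 2) ≤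
      Real.sqrt (W 0 / (α ^ 3 / 3)) * Real.exp (-eta * t) := fun t ht => by
    have hexp : Real.exp (-(2 * eta) * t) = Real.exp (-eta * t) ^ 2 := by
      rw [← Real.exp_nat_mul]; congr 1; push_cast; ring
    rw [← Real.sqrt_sq (Real.exp_pos (-eta * t)).le, ← Real.sqrt_mul' _ (sq_nonneg _), ← hexp]
    refine Real.sqrt_le_sqrt ?_
    rw [div_mul_eq_mul_div, le_div_iff₀ hc]
    have hp0 : 0 ≤ ∑ i, p t i ^ 2 := Finset.sum_nonneg fun i _ => sq_nonneg _
    have hWt : W t = α ^ 3 / 3 * ∑ i, (z t i - ystar) ^ 2 + ∑ i, p t i ^ 2 := rfl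
    linarith [hdecay t ht]
  refine ⟨_, Real.sqrt_nonneg _, hnorm, fun i t ht => ?_⟩
  have habs : |z t i - ystar| ≤ Real.sqrt (∑ i, (z t i - ystar) ^ 2) :=
    Real.abs_le_sqrt (Finset.single_le_sum (f := fun i => (z t i - ystar) ^ 2)
      (fun j _ => sq_nonneg _) (Finset.mem_univ i))
  have hexp : Real.exp (-eta * t) * Real.exp (eta * t) = 1 := by
    rw [← Real.exp_add]; simp
  calc |z t i - ystar| * Real.exp (eta * t)
      ≤ Real.sqrt (W 0 / (α ^ 3 / 3)) * Real.exp (-eta * t) * Real.exp (eta * t) := by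
        gcongr; exact habs.trans (hnorm t ht)
    _ = Real.sqrt (W 0 / (α ^ 3 / 3)) := by rw [mul_assoc, hexp, mul_one]
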